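/- arXiv:1107.1670 — 2 statements merged into one kernel-verified Lean document; each statement's English description precedes it below -/
import Mathlib

section
/- Let E and F be complex Banach spaces, 1 ≤ p < ∞, and let f : E → F be an entire function which is p-compact at x₀ with positive radius of p-compact convergence r = r_p(f,x₀). Then f is p-compact at every x in the open ball B_r(x₀) of center x₀ and radius r. In particular, if f is p-compact at x₀ with infinite radius of p-compact convergence, then f is p-compact at every point of E. -/
open scoped ENNReal NNReal Classical
open Filter Metric

noncomputable section

/-- Membership in the closed unit ball of `ℓ_q`, where `q` is the conjugate exponent of `p`
(`q = ∞`, i.e. bounded coefficients, when `p = 1`). -/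
def ConjUnitBall (p : ℝ) (α : ℕ → ℂ) : Prop :=
  if p = 1 then ∀ n, ‖α n‖ ≤ 1
  else (Summable fun n => ‖α n‖ ^ (p / (p - 1))) ∧ (∑' n, ‖α n‖ ^ (p / (p - 1))) ≤ 1

variable {E F : Type*} [NormedAddCommGroup E] [NormedSpace ℂ E]
  [NormedAddCommGroup F] [NormedSpace ℂ F]

/-- The `p`-convex hull `p-co{x_n}` of a sequence `(x_n)`. -/
def pCo (p : ℝ) (x : ℕ → F) : Set F :=
  {y | ∃ α : ℕ → ℂ, ConjUnitBall p α ∧ HasSum (fun n => α n • x n) y}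

/-- A set is relatively `p`-compact if it is contained in the `p`-convex hull of a
`p`-summable sequence. -/
def IsRelPCompact (p : ℝ) (K : Set F) : Prop :=
  ∃ x : ℕ → F, (Summable fun n => ‖x n‖ ^ p) ∧ K ⊆ pCo p x

/-- The measure of `p`-compactness `m_p(K)`. -/
def mP (p : ℝ) (K : Set F) : ℝ :=
  sInf {r : ℝ | ∃ x : ℕ → F, (Summable fun n => ‖x n‖ ^ p) ∧ K ⊆ pCo p x ∧
    r = (∑' n, ‖x n‖ ^ p) ^ (1 / p)}

/-- `m_p(K)` as an element of `[0, ∞]`; it equals `∞` when `K` is not relatively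
`p`-compact. -/
def mPE (p : ℝ) (K : Set F) : ℝ≥0∞ :=
  sInf {r : ℝ≥0∞ | ∃ x : ℕ → F, (Summable fun n => ‖x n‖ ^ p) ∧ K ⊆ pCo p x ∧
    r = ENNReal.ofReal ((∑' n, ‖x n‖ ^ p) ^ (1 / p))}

/-- The `m`-homogeneous polynomial `P_m f(x₀)` in the Taylor series expansion of `f` at `x₀`. -/
def taylorPoly (f : E → F) (x₀ : E) (m : ℕ) (x : E) : F :=
  ((m.factorial : ℂ))⁻¹ • iteratedFDeriv ℂ m f x₀ fun _ => x

/-- `f` is `p`-compact at `x₀` if some neighborhood of `x₀` has relatively `p`-compact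
image under `f`. -/
def PCompactAt (p : ℝ) (f : E → F) (x₀ : E) : Prop :=
  ∃ V ∈ nhds x₀, IsRelPCompact p (f '' V)

/-- The radius of `p`-compact convergence of `f` at `x₀`:
`r_p(f, x₀) = 1 / limsup κ_p(P_mf(x₀))^{1/m}` (with the conventions `1/0 = ∞`, and
`κ_p(P) = ∞` when `P` is not `p`-compact, so that `r_p(f,x₀) = 0` in that case). -/
def pRadius (p : ℝ) (f : E → F) (x₀ : E) : ℝ≥0∞ :=
  (Filter.limsup (fun m : ℕ => (mPE p (taylorPoly f x₀ m '' closedBall 0 1)) ^ (1 / (m : ℝ)))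
    Filter.atTop)⁻¹

theorem ConjUnitBall.summable_norm_smul {p : ℝ} (hp : 1 ≤ p) {α : ℕ → ℂ} (hα : ConjUnitBall p α)
    {x : ℕ → F} (hx : Summable fun n => ‖x n‖ ^ p) : Summable fun n => ‖α n • x n‖ := by
  simp only [norm_smul]
  unfold ConjUnitBall at hα
  split_ifs at hα with h1
  · subst h1
    simp only [Real.rpow_one] at hx
    exact Summable.of_nonneg_of_le (fun n => by positivity)
      (fun n => mul_le_of_le_one_left (norm_nonneg _) (hα n)) hx
  · have hpq : p.HolderConjugate (p / (p - 1)) :=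
      Real.HolderConjugate.conjExponent (lt_of_le_of_ne hp (Ne.symm h1))
    exact Real.summable_mul_of_Lp_Lq_of_nonneg hpq.symm (fun n => norm_nonneg _)
      (fun n => norm_nonneg _) hα.1 hx

theorem conjUnitBall_zero {p : ℝ} (hp : 1 ≤ p) : ConjUnitBall p 0 := by
  unfold ConjUnitBall
  split_ifs with h1
  · simp
  · have hq : p / (p - 1) ≠ 0 := div_ne_zero (by positivity) (sub_ne_zero.2 h1)
    simp [Real.zero_rpow hq, summable_zero]

/-- Weighting the rows of a sequence of elements of the unit ball of `ℓ_q` by a family of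
coefficients of total mass at most one gives an element of the unit ball of `ℓ_q(ℕ × ℕ)`. -/
theorem ConjUnitBall.weighted {p : ℝ} (hp : 1 ≤ p) {α : ℕ → ℕ → ℂ}
    (hα : ∀ m, ConjUnitBall p (α m)) {c : ℕ → ℝ} (hc0 : ∀ m, 0 ≤ c m) (hc : HasSum c 1) :
    ConjUnitBall p fun k => (c (Nat.pairEquiv.symm k).1 : ℂ) *
      α (Nat.pairEquiv.symm k).1 (Nat.pairEquiv.symm k).2 := by
  have hc1 : ∀ m, c m ≤ 1 := fun m => le_hasSum hc m fun j _ => hc0 j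
  unfold ConjUnitBall at hα ⊢
  split_ifs at hα ⊢ with h1
  · intro k
    rw [norm_mul, Complex.norm_real, Real.norm_of_nonneg (hc0 _)]
    exact mul_le_one₀ (hc1 _) (norm_nonneg _) (hα _ _)
  · set q := p / (p - 1) with hq_def
    have hp1 : 0 < p - 1 := sub_pos.2 (lt_of_le_of_ne hp (Ne.symm h1))
    have hq : 1 ≤ q := by rw [hq_def, le_div_iff₀ hp1]; linarith
    let G : ℕ × ℕ → ℝ := fun k => ‖(c k.1 : ℂ) * α k.1 k.2‖ ^ q
    have hG : ∀ m n, G (m, n) = c m ^ q * ‖α m n‖ ^ q := fun m n => by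
      simp only [G, norm_mul, Complex.norm_real, Real.norm_of_nonneg (hc0 m)]
      exact Real.mul_rpow (hc0 m) (norm_nonneg _)
    have hrow : ∀ m, Summable fun n => G (m, n) := fun m => by
      simp only [hG]; exact (hα m).1.mul_left _
    have hle : ∀ m, ∑' n, G (m, n) ≤ c m := fun m => by
      simp only [hG, tsum_mul_left]
      calc c m ^ q * ∑' n, ‖α m n‖ ^ q ≤ c m ^ q * 1 :=
            mul_le_mul_of_nonneg_left (hα m).2 (Real.rpow_nonneg (hc0 m) _)
        _ ≤ c m := by
            rw [mul_one]
            simpa using Real.rpow_le_rpow_of_exponent_ge_of_imp (hc0 m) (hc1 m) hq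
              (fun _ h => by linarith)
    have hG0 : 0 ≤ G := fun k => by positivity
    have hsum' : Summable fun m => ∑' n, G (m, n) :=
      Summable.of_nonneg_of_le (fun m => tsum_nonneg fun n => hG0 _) hle hc.summable
    have hsum : Summable G := (summable_prod_of_nonneg hG0).2 ⟨hrow, hsum'⟩
    refine ⟨(Nat.pairEquiv.symm.summable_iff (f := G)).2 hsum, ?_⟩
    calc ∑' k, G (Nat.pairEquiv.symm k) = ∑' k, G k := Nat.pairEquiv.symm.tsum_eq G
      _ = ∑' m, ∑' n, G (m, n) := hsum.tsum_prod' hrow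
      _ ≤ ∑' m, c m := hsum'.tsum_le_tsum hle hc.summable
      _ = 1 := hc.tsum_eq

/-- The image of a pointwise convergent series of maps is relatively `p`-compact as soon as the
terms have relatively `p`-compact images whose measures decay geometrically. -/
theorem isRelPCompact_image_of_hasSum [CompleteSpace F] {X : Type*} {p : ℝ} (hp : 1 ≤ p)
    {S : Set X} {g : ℕ → X → F} {f : X → F} {x : ℕ → ℕ → F} {a : ℝ} (ha0 : 0 < a) (ha1 : a < 1)
    (hx : ∀ m, Summable fun n => ‖x m n‖ ^ p)
    (hxa : ∀ᶠ m in atTop, ∑' n, ‖x m n‖ ^ p ≤ (a ^ m) ^ p)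
    (hg : ∀ m, g m '' S ⊆ pCo p (x m)) (hf : ∀ y ∈ S, HasSum (fun m => g m y) (f y)) :
    IsRelPCompact p (f '' S) := by
  set ρ := √a with hρ
  have hρ0 : 0 < ρ := Real.sqrt_pos.2 ha0
  have hρ1 : ρ < 1 := by rw [hρ, Real.sqrt_lt' one_pos]; simpa using ha1
  have hρa : ρ * ρ = a := Real.mul_self_sqrt ha0.le
  have hρ' : 0 < 1 - ρ := sub_pos.2 hρ1
  let c : ℕ → ℝ := fun m => (1 - ρ) * ρ ^ m
  have hc0 : ∀ m, 0 < c m := fun m => by positivity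
  have hc : HasSum c 1 := by
    have := (hasSum_geometric_of_lt_one hρ0.le hρ1).mul_left (1 - ρ)
    rwa [mul_inv_cancel₀ hρ'.ne'] at this
  let e : ℕ ≃ ℕ × ℕ := Nat.pairEquiv.symm
  let Z : ℕ × ℕ → F := fun k => ((c k.1 : ℂ))⁻¹ • x k.1 k.2
  have hZn : ∀ m n, ‖Z (m, n)‖ ^ p = ((c m)⁻¹) ^ p * ‖x m n‖ ^ p := fun m n => by
    simp only [Z, norm_smul, norm_inv, Complex.norm_real, Real.norm_of_nonneg (hc0 m).le]
    exact Real.mul_rpow (inv_nonneg.2 (hc0 m).le) (norm_nonneg _)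
  have hZ : Summable fun k => ‖Z k‖ ^ p := by
    refine (summable_prod_of_nonneg fun k => by positivity).2 ⟨fun m => ?_, ?_⟩
    · simp only [hZn]; exact (hx m).mul_left _
    · simp only [hZn, tsum_mul_left]
      have hgeo : Summable fun m : ℕ => ((1 - ρ)⁻¹) ^ p * (ρ ^ p) ^ m :=
        (summable_geometric_of_lt_one (by positivity)
          (Real.rpow_lt_one hρ0.le hρ1 (by linarith))).mul_left _
      refine summable_of_isBigO_nat hgeo (Asymptotics.IsBigO.of_bound 1 ?_)
      filter_upwards [hxa] with m hm
      have h0 : 0 ≤ ∑' n, ‖x m n‖ ^ p := tsum_nonneg fun n => by positivity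
      have hcm := hc0 m
      rw [one_mul, Real.norm_of_nonneg (by positivity), Real.norm_of_nonneg (by positivity)]
      calc ((c m)⁻¹) ^ p * ∑' n, ‖x m n‖ ^ p ≤ ((c m)⁻¹) ^ p * (a ^ m) ^ p := by gcongr
        _ = ((1 - ρ)⁻¹ * ρ ^ m) ^ p := by
            rw [← Real.mul_rpow (by positivity) (by positivity)]
            congr 1
            simp only [c]
            rw [← hρa, mul_pow]
            field_simp
        _ = ((1 - ρ)⁻¹) ^ p * (ρ ^ p) ^ m := by
            rw [Real.mul_rpow (by positivity) (by positivity), ← Real.rpow_natCast,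
              ← Real.rpow_natCast, ← Real.rpow_mul hρ0.le, ← Real.rpow_mul hρ0.le, mul_comm p]
  refine ⟨Z ∘ e, (e.summable_iff (f := fun k => ‖Z k‖ ^ p)).2 hZ, ?_⟩
  rintro _ ⟨y, hy, rfl⟩
  choose α hα hαs using fun m => hg m (Set.mem_image_of_mem (g m) hy)
  have hA := ConjUnitBall.weighted hp hα (fun m => (hc0 m).le) hc
  refine ⟨_, hA, ?_⟩
  have hs := (hA.summable_norm_smul hp (x := Z ∘ e)
    ((e.summable_iff (f := fun k => ‖Z k‖ ^ p)).2 hZ)).of_norm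
  obtain ⟨v, hv⟩ := hs
  have hterm : ∀ k : ℕ × ℕ, ((c k.1 : ℂ) * α k.1 k.2) • Z k = α k.1 k.2 • x k.1 k.2 := by
    intro k
    have : (c k.1 : ℂ) ≠ 0 := by exact_mod_cast (hc0 k.1).ne'
    simp only [Z, smul_smul]
    congr 1
    field_simp
  have hv' : HasSum (fun k : ℕ × ℕ => α k.1 k.2 • x k.1 k.2) v := by
    rw [← e.hasSum_iff]
    convert hv using 2 with k
    exact (hterm (e k)).symm
  have hfy : v = f y := (hv'.prod_fiberwise hαs).unique (hf y hy)
  rwa [hfy] at hv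

theorem IsRelPCompact.mono {p : ℝ} {K L : Set F} (hL : IsRelPCompact p L) (h : K ⊆ L) :
    IsRelPCompact p K := by
  obtain ⟨x, hx, hxL⟩ := hL
  exact ⟨x, hx, h.trans hxL⟩

theorem zero_mem_pCo {p : ℝ} (hp : 1 ≤ p) (x : ℕ → F) : (0 : F) ∈ pCo p x :=
  ⟨0, conjUnitBall_zero hp, by simp [hasSum_zero]⟩

theorem smul_mem_pCo {p : ℝ} {x : ℕ → F} {y : F} (hy : y ∈ pCo p x) (c : ℂ) :
    c • y ∈ pCo p fun n => c • x n := by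
  obtain ⟨α, hα, hs⟩ := hy
  exact ⟨α, hα, by simpa only [smul_comm c] using hs.const_smul c⟩

theorem norm_smul_rpow (p : ℝ) (c : ℂ) (y : F) : ‖c • y‖ ^ p = ‖c‖ ^ p * ‖y‖ ^ p := by
  rw [norm_smul, Real.mul_rpow (norm_nonneg _) (norm_nonneg _)]

theorem IsRelPCompact.const_smul_image {X : Type*} {p : ℝ} {S : Set X} {g : X → F}
    (hg : IsRelPCompact p (g '' S)) (c : ℂ) : IsRelPCompact p ((fun y => c • g y) '' S) := by
  obtain ⟨x, hx, hxg⟩ := hg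
  refine ⟨fun n => c • x n, by simpa only [norm_smul_rpow] using hx.mul_left _, ?_⟩
  rintro _ ⟨y, hy, rfl⟩
  exact smul_mem_pCo (hxg ⟨y, hy, rfl⟩) c

theorem IsRelPCompact.sum_image [CompleteSpace F] {X : Type*} {p : ℝ} (hp : 1 ≤ p) {S : Set X}
    (g : ℕ → X → F) (M : ℕ) (hg : ∀ m < M, IsRelPCompact p (g m '' S)) :
    IsRelPCompact p ((fun y => ∑ m ∈ Finset.range M, g m y) '' S) := by
  have hp0 : p ≠ 0 := by positivity
  have h : ∀ m, ∃ x : ℕ → F, (Summable fun n => ‖x n‖ ^ p) ∧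
      (m < M → g m '' S ⊆ pCo p x) ∧ (M ≤ m → x = 0) := fun m => by
    by_cases hm : m < M
    · obtain ⟨x, hx, hxg⟩ := hg m hm
      exact ⟨x, hx, fun _ => hxg, fun h => absurd hm h.not_gt⟩
    · exact ⟨0, by simp [Real.zero_rpow hp0, summable_zero], fun h => absurd h hm, fun _ => rfl⟩
  choose x hx hxg hx0 using h
  refine isRelPCompact_image_of_hasSum hp (a := 1 / 2) (x := x)
    (g := fun m y => if m < M then g m y else 0) (by norm_num) (by norm_num) hx ?_ ?_ ?_
  · filter_upwards [eventually_ge_atTop M] with m hm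
    simp only [hx0 m hm, Pi.zero_apply, norm_zero, Real.zero_rpow hp0, tsum_zero]
    positivity
  · rintro m _ ⟨y, hy, rfl⟩
    by_cases hm : m < M
    · simpa [hm] using hxg m hm ⟨y, hy, rfl⟩
    · simpa [hm] using zero_mem_pCo hp (x m)
  · intro y _
    have h2 := hasSum_sum_of_ne_finset_zero (L := .unconditional ℕ)
      (f := fun m => if m < M then g m y else 0)
      (s := Finset.range M) (fun m hm => by simp_all)
    convert h2 using 1
    exact Finset.sum_congr rfl fun m hm => by simp [Finset.mem_range.1 hm]

theorem IsRelPCompact.sub_image [CompleteSpace F] {X : Type*} {p : ℝ} (hp : 1 ≤ p) {S : Set X}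
    {g h : X → F} (hg : IsRelPCompact p (g '' S)) (hh : IsRelPCompact p (h '' S)) :
    IsRelPCompact p ((fun y => g y - h y) '' S) := by
  have := IsRelPCompact.sum_image hp (fun m => if m = 0 then g else fun y => (-1 : ℂ) • h y) 2
    (S := S) (fun m _ => by
      by_cases hm : m = 0
      · simpa [hm] using hg
      · simpa only [if_neg hm] using hh.const_smul_image (-1))
  simpa [Finset.sum_range_succ, sub_eq_add_neg] using this

/-- The homogeneous components of a polynomial with relatively `p`-compact image of a ball have
relatively `p`-compact images of that ball. -/
theorem isRelPCompact_of_sum_homogeneous [CompleteSpace F] {p : ℝ} (hp : 1 ≤ p) {r : ℝ} (M : ℕ)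
    (P : ℕ → E → F) (hP : ∀ m (c : ℂ) h, P m (c • h) = c ^ m • P m h)
    (hQ : IsRelPCompact p ((fun h => ∑ m ∈ Finset.range M, P m h) '' closedBall 0 r)) :
    ∀ m < M, IsRelPCompact p (P m '' closedBall 0 r) := by
  induction M generalizing P with
  | zero => simp
  | succ M ih =>
    have hlow : ∀ m < M, IsRelPCompact p (P m '' closedBall 0 r) := by
      intro m hm
      have hhalf : IsRelPCompact p
          ((fun h => ∑ m ∈ Finset.range (M + 1), P m ((2⁻¹ : ℂ) • h)) '' closedBall 0 r) := by
        refine hQ.mono ?_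
        rintro _ ⟨h, hh, rfl⟩
        refine ⟨(2⁻¹ : ℂ) • h, ?_, rfl⟩
        rw [mem_closedBall_zero_iff] at hh ⊢
        rw [norm_smul]
        norm_num
        linarith [norm_nonneg h]
      have hR := IsRelPCompact.sub_image hp (hhalf.const_smul_image ((2 : ℂ) ^ M)) hQ
      have hne : (2 : ℂ) ^ M * (2⁻¹) ^ m - 1 ≠ 0 := by
        rw [inv_pow, sub_ne_zero]
        intro h
        have h2 : (2 : ℂ) ^ M = 2 ^ m := by field_simp at h; exact h
        have h3 : 2 ^ M = 2 ^ m := by exact_mod_cast h2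
        exact hm.ne' (Nat.pow_right_injective le_rfl h3)
      have := ih (fun m h => ((2 : ℂ) ^ M * (2⁻¹) ^ m - 1) • P m h)
        (fun m c h => by rw [hP, smul_comm]) (by
          convert hR using 3 with h
          rw [Finset.sum_range_succ, Finset.sum_range_succ, smul_add, hP, smul_smul, ← mul_pow,
            mul_inv_cancel₀ two_ne_zero, one_pow, one_smul, add_sub_add_right_eq_sub,
            Finset.smul_sum, ← Finset.sum_sub_distrib]
          exact Finset.sum_congr rfl fun k _ => by rw [hP, sub_smul, one_smul, smul_smul]) m hm
      simpa only [smul_smul, inv_mul_cancel₀ hne, one_smul] using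
        this.const_smul_image ((2 : ℂ) ^ M * (2⁻¹) ^ m - 1)⁻¹
    intro m hm
    rcases Nat.lt_succ_iff_lt_or_eq.1 hm with hm | rfl
    · exact hlow m hm
    · have := IsRelPCompact.sub_image hp hQ (IsRelPCompact.sum_image hp P m hlow)
      simpa only [Finset.sum_range_succ, add_sub_cancel_left] using this

theorem taylorPoly_smul (f : E → F) (x₀ : E) (m : ℕ) (c : ℂ) (h : E) :
    taylorPoly f x₀ m (c • h) = c ^ m • taylorPoly f x₀ m h := by
  unfold taylorPoly
  rw [(iteratedFDeriv ℂ m f x₀).map_smul_univ (fun _ => c) (fun _ => h), smul_comm]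
  simp

/-- The Taylor series of an entire map converges pointwise everywhere. -/
theorem hasSum_taylorPoly [CompleteSpace F] {f : E → F} (hf : ∀ x, AnalyticAt ℂ f x) (x₀ h : E) :
    HasSum (fun m => taylorPoly f x₀ m h) (f (x₀ + h)) := by
  let g : ℂ → F := fun t => f (x₀ + t • h)
  have hg : Differentiable ℂ g := fun t =>
    (hf _).differentiableAt.comp t (by fun_prop)
  have hglob := hg.hasFPowerSeriesOnBall 0 one_pos
  let q : FormalMultilinearSeries ℂ ℂ F := fun m =>
    ContinuousMultilinearMap.mkPiRing ℂ (Fin m) (taylorPoly f x₀ m h)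
  have hq : HasFPowerSeriesAt g q 0 := by
    rw [hasFPowerSeriesAt_iff]
    obtain ⟨ps, R, hR⟩ := hf x₀
    have hcont : Tendsto (fun t : ℂ => t • h) (nhds 0) (nhds 0) := by
      have : Continuous fun t : ℂ => t • h := by fun_prop
      simpa using this.tendsto 0
    filter_upwards [hcont (Metric.eball_mem_nhds 0 hR.r_pos)] with t ht
    have := hR.hasSum_iteratedFDeriv ht
    convert this using 1
    · ext m
      have h1 := taylorPoly_smul f x₀ m t h
      unfold taylorPoly at h1
      rw [h1]
      simp [FormalMultilinearSeries.coeff, q, taylorPoly]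
    · simp [g]
  have heq := hq.eq_formalMultilinearSeries hglob.hasFPowerSeriesAt
  rw [← heq] at hglob
  have := hglob.hasSum (y := 1) (by simp)
  simpa [q, g] using this

/-- Inside the radius of `p`-compact convergence, the Taylor polynomials have geometrically
decaying measures of `p`-compactness. -/
theorem eventually_exists_taylorPoly_subset_pCo {p : ℝ} (hp : 1 ≤ p) {f : E → F} {x₀ : E}
    {s t : ℝ≥0} (hs : 0 < s) (hst : s < t) (ht : (t : ℝ≥0∞) < pRadius p f x₀) :
    ∀ᶠ m in atTop, ∃ x : ℕ → F, (Summable fun n => ‖x n‖ ^ p) ∧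
      taylorPoly f x₀ m '' closedBall 0 s ⊆ pCo p x ∧
      ∑' n, ‖x n‖ ^ p ≤ (((s / t : ℝ≥0) : ℝ) ^ m) ^ p := by
  have ht0 : 0 < t := hs.trans hst
  have hlim := ENNReal.lt_inv_iff_lt_inv.1 ht
  filter_upwards [eventually_lt_of_limsup_lt hlim, eventually_gt_atTop 0] with m hm hm0
  have hm' : mPE p (taylorPoly f x₀ m '' closedBall 0 1) < ((t : ℝ≥0∞)⁻¹) ^ m := by
    have hm1 : (0 : ℝ) < m := by exact_mod_cast hm0
    have := ENNReal.rpow_lt_rpow hm hm1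
    rwa [← ENNReal.rpow_mul, one_div, inv_mul_cancel₀ hm1.ne', ENNReal.rpow_one,
      ENNReal.rpow_natCast] at this
  obtain ⟨_, ⟨x, hx, hxP, rfl⟩, hlt⟩ := sInf_lt_iff.1 hm'
  have hS0 : 0 ≤ ∑' n, ‖x n‖ ^ p := tsum_nonneg fun n => by positivity
  have hle : ∑' n, ‖x n‖ ^ p ≤ (((t : ℝ)⁻¹) ^ m) ^ p := by
    rw [← ENNReal.coe_inv ht0.ne', ← ENNReal.coe_pow, ENNReal.ofReal_lt_coe_iff
      (by positivity)] at hlt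
    rw [← Real.rpow_inv_le_iff_of_pos hS0 (by positivity) (by positivity), ← one_div]
    simpa using hlt.le
  refine ⟨fun n => ((s : ℝ) : ℂ) ^ m • x n, ?_, ?_, ?_⟩
  · simpa only [norm_smul_rpow] using hx.mul_left _
  · rintro _ ⟨h, hh, rfl⟩
    have hs' : ((s : ℝ) : ℂ) ≠ 0 := by exact_mod_cast hs.ne'
    have hh' : h = ((s : ℝ) : ℂ) • (((s : ℝ) : ℂ)⁻¹ • h) := by
      rw [smul_smul, mul_inv_cancel₀ hs', one_smul]
    rw [hh', taylorPoly_smul]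
    refine smul_mem_pCo (hxP ⟨_, ?_, rfl⟩) _
    rw [mem_closedBall_zero_iff] at hh ⊢
    have hs1 : (0 : ℝ) < s := hs
    rw [norm_smul, norm_inv, Complex.norm_real, Real.norm_of_nonneg hs1.le, inv_mul_le_iff₀ hs1,
      mul_one]
    exact hh
  · simp only [norm_smul_rpow, tsum_mul_left, norm_pow, Complex.norm_real,
      Real.norm_of_nonneg s.coe_nonneg]
    calc ((s : ℝ) ^ m) ^ p * ∑' n, ‖x n‖ ^ p
        ≤ ((s : ℝ) ^ m) ^ p * (((t : ℝ)⁻¹) ^ m) ^ p := by gcongr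
      _ = _ := by
        rw [← Real.mul_rpow (by positivity) (by positivity), ← mul_pow, NNReal.coe_div,
          div_eq_mul_inv]

/-- If `f` is `p`-compact at `x₀` with positive radius of `p`-compact convergence, all its Taylor
polynomials at `x₀` are `p`-compact. -/
theorem isRelPCompact_taylorPoly [CompleteSpace F] {p : ℝ} (hp : 1 ≤ p) {f : E → F}
    (hf : ∀ x, AnalyticAt ℂ f x) {x₀ : E} (hfp : PCompactAt p f x₀) {s t : ℝ≥0} (hs : 0 < s)
    (hst : s < t) (ht : (t : ℝ≥0∞) < pRadius p f x₀) (m : ℕ) :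
    IsRelPCompact p (taylorPoly f x₀ m '' closedBall 0 s) := by
  have hp0 : p ≠ 0 := by positivity
  have ht0 : 0 < t := hs.trans hst
  have hs0 : (0 : ℝ) < s := hs
  obtain ⟨V, hV, hfV⟩ := hfp
  obtain ⟨δ, hδ, hδV⟩ := Metric.nhds_basis_closedBall.mem_iff.1 hV
  set ε : ℝ := min δ s
  have hε : 0 < ε := lt_min hδ hs0
  obtain ⟨N, hN⟩ := eventually_atTop.1 (eventually_exists_taylorPoly_subset_pCo hp hs hst ht)
  set M := max N (m + 1)
  have hfloc : IsRelPCompact p ((fun h => f (x₀ + h)) '' closedBall 0 ε) := by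
    refine hfV.mono ?_
    rintro _ ⟨h, hh, rfl⟩
    refine ⟨x₀ + h, hδV ?_, rfl⟩
    rw [mem_closedBall_zero_iff] at hh
    simpa using hh.trans (min_le_left _ _)
  have hex : ∀ k, ∃ x : ℕ → F, (Summable fun n => ‖x n‖ ^ p) ∧
      (fun h => if k < M then 0 else taylorPoly f x₀ k h) '' closedBall 0 ε ⊆ pCo p x ∧
      ∑' n, ‖x n‖ ^ p ≤ (((s / t : ℝ≥0) : ℝ) ^ k) ^ p := fun k => by
    by_cases hk : k < M
    · refine ⟨0, by simp [Real.zero_rpow hp0, summable_zero], ?_, ?_⟩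
      · rintro _ ⟨h, _, rfl⟩
        simpa [hk] using zero_mem_pCo hp (0 : ℕ → F)
      · simp only [Pi.zero_apply, norm_zero, Real.zero_rpow hp0, tsum_zero]
        positivity
    · obtain ⟨x, hx, hxP, hxs⟩ := hN k ((le_max_left _ _).trans (not_lt.1 hk))
      refine ⟨x, hx, ?_, hxs⟩
      simp only [hk, if_false]
      exact (Set.image_mono (closedBall_subset_closedBall (min_le_right _ _))).trans hxP
  choose x hx hxP hxs using hex
  have htail : IsRelPCompact p ((fun h => f (x₀ + h) -
      ∑ k ∈ Finset.range M, taylorPoly f x₀ k h) '' closedBall 0 ε) := by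
    refine isRelPCompact_image_of_hasSum hp (a := (s / t : ℝ≥0)) (by positivity)
      (by exact_mod_cast (div_lt_one ht0).2 hst) hx (Eventually.of_forall hxs) hxP fun h _ => ?_
    have h1 := hasSum_taylorPoly hf x₀ h
    have h2 := hasSum_sum_of_ne_finset_zero (L := .unconditional ℕ)
      (f := fun k => if k < M then taylorPoly f x₀ k h else 0)
      (s := Finset.range M) (fun k hk => by simp_all)
    rw [Finset.sum_congr rfl fun k hk => if_pos (Finset.mem_range.1 hk)] at h2
    convert h1.sub h2 using 2 with k
    split_ifs <;> simp
  have hpoly := IsRelPCompact.sub_image hp hfloc htail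
  simp only [sub_sub_cancel] at hpoly
  have hball := isRelPCompact_of_sum_homogeneous hp M (taylorPoly f x₀)
    (taylorPoly_smul f x₀) hpoly m (lt_of_lt_of_le (Nat.lt_succ_self m) (le_max_right _ _))
  have hd : 0 < (s : ℝ) / ε := by positivity
  have hd' : (((s : ℝ) / ε : ℝ) : ℂ) ≠ 0 := by exact_mod_cast hd.ne'
  refine (hball.const_smul_image ((((s : ℝ) / ε : ℝ) : ℂ) ^ m)).mono ?_
  rintro _ ⟨h, hh, rfl⟩
  refine ⟨(((s : ℝ) / ε : ℝ) : ℂ)⁻¹ • h, ?_, ?_⟩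
  · rw [mem_closedBall_zero_iff] at hh ⊢
    rw [norm_smul, norm_inv, Complex.norm_real, Real.norm_of_nonneg hd.le, inv_mul_le_iff₀ hd,
      div_mul_cancel₀ _ hε.ne']
    exact hh
  · simp only
    rw [← taylorPoly_smul, smul_smul, mul_inv_cancel₀ hd', one_smul]

/-- An entire map that is `p`-compact at `x₀` is `p`-compact at every point of the open ball whose
radius is the radius of `p`-compact convergence at `x₀`. -/
theorem PCompactAt.of_lt_pRadius [CompleteSpace F] {p : ℝ} (hp : 1 ≤ p) {f : E → F}
    (hf : ∀ x, AnalyticAt ℂ f x) {x₀ x : E} (hfp : PCompactAt p f x₀)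
    (hx : ENNReal.ofReal ‖x - x₀‖ < pRadius p f x₀) : PCompactAt p f x := by
  obtain ⟨s, hxs, hsr⟩ := ENNReal.lt_iff_exists_nnreal_btwn.1 hx
  obtain ⟨t, hst, ht⟩ := ENNReal.lt_iff_exists_nnreal_btwn.1 hsr
  have hst : s < t := by exact_mod_cast hst
  have hxs : ‖x - x₀‖ < s := by rwa [ENNReal.ofReal_lt_coe_iff (norm_nonneg _)] at hxs
  have hs : 0 < s := by exact_mod_cast (norm_nonneg _).trans_lt hxs
  have ht0 : 0 < t := hs.trans hst
  have hex : ∀ m, ∃ z : ℕ → F, (Summable fun n => ‖z n‖ ^ p) ∧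
      taylorPoly f x₀ m '' closedBall 0 s ⊆ pCo p z ∧
      ((∃ z' : ℕ → F, (Summable fun n => ‖z' n‖ ^ p) ∧
        taylorPoly f x₀ m '' closedBall 0 s ⊆ pCo p z' ∧
        ∑' n, ‖z' n‖ ^ p ≤ (((s / t : ℝ≥0) : ℝ) ^ m) ^ p) →
      ∑' n, ‖z n‖ ^ p ≤ (((s / t : ℝ≥0) : ℝ) ^ m) ^ p) := fun m => by
    by_cases h : ∃ z' : ℕ → F, (Summable fun n => ‖z' n‖ ^ p) ∧
        taylorPoly f x₀ m '' closedBall 0 s ⊆ pCo p z' ∧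
        ∑' n, ‖z' n‖ ^ p ≤ (((s / t : ℝ≥0) : ℝ) ^ m) ^ p
    · obtain ⟨z, hz, hzP, hzs⟩ := h
      exact ⟨z, hz, hzP, fun _ => hzs⟩
    · obtain ⟨z, hz, hzP⟩ := isRelPCompact_taylorPoly hp hf hfp hs hst ht m
      exact ⟨z, hz, hzP, fun h' => absurd h' h⟩
  choose z hz hzP hzs using hex
  have hmain : IsRelPCompact p ((fun h => f (x₀ + h)) '' closedBall 0 s) :=
    isRelPCompact_image_of_hasSum hp (a := (s / t : ℝ≥0)) (by positivity)
      (by exact_mod_cast (div_lt_one ht0).2 hst) hz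
      ((eventually_exists_taylorPoly_subset_pCo hp hs hst ht).mono hzs) hzP
      fun h _ => hasSum_taylorPoly hf x₀ h
  refine ⟨ball x₀ s, isOpen_ball.mem_nhds (by rwa [mem_ball, dist_eq_norm]), hmain.mono ?_⟩
  rintro _ ⟨y, hy, rfl⟩
  rw [mem_ball, dist_eq_norm] at hy
  exact ⟨y - x₀, by rw [mem_closedBall_zero_iff]; exact hy.le, by simp⟩

/-- **Proposition 3.6.** Let `E`, `F` be complex Banach spaces, `1 ≤ p < ∞`, and `f : E → F`
entire and `p`-compact at `x₀` with positive radius of `p`-compact convergence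
`r = r_p(f, x₀)`.  Then `f` is `p`-compact at every point of the open ball `B_r(x₀)`.
In particular, if the radius is infinite then `f` is `p`-compact at every point of `E`. -/
theorem statement8 [CompleteSpace E] [CompleteSpace F] (p : ℝ) (hp : 1 ≤ p)
    (f : E → F) (hf : ∀ x, AnalyticAt ℂ f x) (x₀ : E)
    (hfp : PCompactAt p f x₀) (hr : 0 < pRadius p f x₀) :
    (∀ x : E, ENNReal.ofReal ‖x - x₀‖ < pRadius p f x₀ → PCompactAt p f x) ∧
    (pRadius p f x₀ = ⊤ → ∀ x : E, PCompactAt p f x) := by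
  have h := fun x hx => hfp.of_lt_pRadius (x := x) hp hf hx
  exact ⟨h, fun htop x => h x (by rw [htop]; exact ENNReal.ofReal_lt_top)⟩

end
end

section
/- Let 1 ≤ p < ∞ and let {σ_m}_{m≥1} be the partition of ℕ into consecutive blocks where σ_m consists of m! consecutive integers (σ₁ = {1}, σ₂ = {2,3}, σ₃ = {4,…,9}, etc.). For each m ≥ 1 define the m-homogeneous polynomial P_m : ℓ₁ → ℓ_p by P_m(x) = (m^{m/2}/m!)^{1/p} ∑_{j∈σ_m} (e′_j(x))^m e_j, where e′_j are the coordinate functionals on ℓ₁ and (e_j) is the canonical basis of ℓ_p. Then ‖P_m‖ ≤ (m^{m/2}/m!)^{1/p}, P_m is p-compact, and κ_p(P_m) ≥ m^{m/(2p)}. -/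
open scoped ENNReal NNReal Classical
open Filter Metric

noncomputable section

variable {E F : Type*} [NormedAddCommGroup E] [NormedSpace ℂ E]
  [NormedAddCommGroup F] [NormedSpace ℂ F]

instance (p : ℝ) [hp : Fact (1 ≤ p)] : Fact (1 ≤ ENNReal.ofReal p) :=
  ⟨by rw [← ENNReal.ofReal_one]; exact ENNReal.ofReal_le_ofReal hp.out⟩

/-- `blockSum m = 1! + 2! + ⋯ + m!`, the index where the block `σ_{m+1}` starts. -/
def blockSum (m : ℕ) : ℕ := ∑ k ∈ Finset.range m, Nat.factorial (k + 1)

/-- The `m`-th block `σ_m` of `m!` consecutive integers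
(`σ₁ = {1}`, `σ₂ = {2,3}`, `σ₃ = {4,…,9}`, …, here indexed starting at `0`). -/
def sigmaBlock (m : ℕ) : Finset ℕ := Finset.Ico (blockSum (m - 1)) (blockSum m)

/-- The `m`-homogeneous polynomial
`P_m(x) = (m^{m/2}/m!)^{1/p} ∑_{j ∈ σ_m} (e'_j(x))^m e_j` from `ℓ₁` to `ℓ_p`. -/
def examplePoly (p : ℝ) [Fact (1 ≤ p)] (m : ℕ) (x : lp (fun _ : ℕ => ℂ) 1) :
    lp (fun _ : ℕ => ℂ) (ENNReal.ofReal p) :=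
  ((((m : ℝ) ^ ((m : ℝ) / 2) / (Nat.factorial m : ℝ)) ^ (1 / p) : ℝ) : ℂ) •
    ∑ j ∈ sigmaBlock m, (x j) ^ m • lp.single (ENNReal.ofReal p) j (1 : ℂ)

theorem card_sigmaBlock {m : ℕ} (hm : 1 ≤ m) : (sigmaBlock m).card = m.factorial := by
  obtain ⟨k, rfl⟩ := Nat.exists_eq_add_of_le' hm
  simp [sigmaBlock, blockSum, Finset.sum_range_succ]

/-- Hölder's inequality for the pairing of `ℓ_p` with the closed unit ball of `ℓ_q`. -/
theorem ConjUnitBall.norm_rpow_le_tsum {p : ℝ} (hp : 1 ≤ p) {α a : ℕ → ℂ} {b : ℂ}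
    (hα : ConjUnitBall p α) (ha : Summable fun n => ‖a n‖ ^ p)
    (hb : HasSum (fun n => α n * a n) b) : ‖b‖ ^ p ≤ ∑' n, ‖a n‖ ^ p := by
  have hp0 : 0 < p := by linarith
  unfold ConjUnitBall at hα
  split_ifs at hα with h1
  · subst h1
    simp only [Real.rpow_one] at ha ⊢
    rw [← hb.tsum_eq]
    exact tsum_of_norm_bounded ha.hasSum fun n => by
      rw [norm_mul]
      exact mul_le_of_le_one_left (norm_nonneg _) (hα n)
  · have hp1 : 1 < p := lt_of_le_of_ne hp (Ne.symm h1)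
    have hpq : p.HolderConjugate (p / (p - 1)) := Real.HolderConjugate.conjExponent hp1
    obtain ⟨hs, hle⟩ := Real.summable_and_inner_le_Lp_mul_Lq_tsum_of_nonneg hpq
      (fun n => norm_nonneg (a n)) (fun n => norm_nonneg (α n)) ha hα.1
    have hbound : ‖b‖ ≤ (∑' n, ‖a n‖ ^ p) ^ (1 / p) := by
      rw [← hb.tsum_eq]
      refine (tsum_of_norm_bounded hs.hasSum fun n => ?_).trans (hle.trans ?_)
      · rw [norm_mul, mul_comm]
      · refine mul_le_of_le_one_right (Real.rpow_nonneg (tsum_nonneg fun n => by positivity) _) ?_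
        exact Real.rpow_le_one (tsum_nonneg fun n => by positivity) hα.2
          (one_div_nonneg.2 hpq.symm.nonneg)
    calc ‖b‖ ^ p ≤ ((∑' n, ‖a n‖ ^ p) ^ (1 / p)) ^ p :=
          Real.rpow_le_rpow (norm_nonneg _) hbound hp0.le
      _ = ∑' n, ‖a n‖ ^ p := by
          rw [one_div, Real.rpow_inv_rpow (tsum_nonneg fun n => by positivity) hp0.ne']

theorem sum_norm_apply_le_one {x : lp (fun _ : ℕ => ℂ) 1} (hx : x ∈ closedBall 0 1)
    (s : Finset ℕ) : ∑ j ∈ s, ‖x j‖ ≤ 1 := by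
  have h := lp.sum_rpow_le_norm_rpow (p := 1) (by simp) x s
  simp only [ENNReal.toReal_one, Real.rpow_one] at h
  exact h.trans (mem_closedBall_zero_iff.1 hx)

theorem norm_apply_le_one {x : lp (fun _ : ℕ => ℂ) 1} (hx : x ∈ closedBall 0 1) (j : ℕ) :
    ‖x j‖ ≤ 1 := by
  simpa using sum_norm_apply_le_one hx {j}

theorem sum_norm_pow_le_one {x : lp (fun _ : ℕ => ℂ) 1} (hx : x ∈ closedBall 0 1)
    {m : ℕ} (hm : 1 ≤ m) (s : Finset ℕ) : ∑ j ∈ s, ‖x j‖ ^ m ≤ 1 :=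
  (Finset.sum_le_sum fun j _ => pow_le_of_le_one (norm_nonneg _) (norm_apply_le_one hx j)
    (Nat.one_le_iff_ne_zero.1 hm)).trans (sum_norm_apply_le_one hx s)

/-- Finitely supported coefficients in the unit ball of `ℓ_1` lie in the unit ball of `ℓ_q`. -/
theorem conjUnitBall_of_sum_norm_le_one {p : ℝ} (hp : 1 ≤ p) {α : ℕ → ℂ} {s : Finset ℕ}
    (hs : ∀ n ∉ s, α n = 0) (hα : ∑ n ∈ s, ‖α n‖ ≤ 1) : ConjUnitBall p α := by
  have hle : ∀ n, ‖α n‖ ≤ 1 := fun n => by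
    by_cases hn : n ∈ s
    · exact (Finset.single_le_sum (fun i _ => norm_nonneg (α i)) hn).trans hα
    · simp [hs n hn]
  unfold ConjUnitBall
  split_ifs with h1
  · exact hle
  · have hp1 : 1 < p := lt_of_le_of_ne hp (Ne.symm h1)
    have hq : 1 < p / (p - 1) := by
      rw [one_lt_div (by linarith)]
      linarith
    have hz : ∀ n ∉ s, ‖α n‖ ^ (p / (p - 1)) = 0 := fun n hn => by
      rw [hs n hn, norm_zero, Real.zero_rpow (by linarith)]
    refine ⟨summable_of_ne_finset_zero hz, ?_⟩
    rw [tsum_eq_sum hz]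
    refine (Finset.sum_le_sum fun n _ => ?_).trans hα
    exact Real.rpow_le_self_of_le_one (norm_nonneg _) (hle n) hq.le

/-- The scaling constant `(m^{m/2}/m!)^{1/p}` of the polynomial `examplePoly p m`. -/
def exampleCoeff (p : ℝ) (m : ℕ) : ℝ :=
  ((m : ℝ) ^ ((m : ℝ) / 2) / (Nat.factorial m : ℝ)) ^ (1 / p)

theorem exampleCoeff_nonneg (p : ℝ) (m : ℕ) : 0 ≤ exampleCoeff p m := by
  unfold exampleCoeff
  positivity

theorem exampleCoeff_rpow {p : ℝ} (hp : 1 ≤ p) (m : ℕ) :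
    exampleCoeff p m ^ p = (m : ℝ) ^ ((m : ℝ) / 2) / (Nat.factorial m : ℝ) := by
  rw [exampleCoeff, one_div, Real.rpow_inv_rpow (by positivity) (by linarith)]

theorem examplePoly_eq (p : ℝ) [Fact (1 ≤ p)] (m : ℕ) (x : lp (fun _ : ℕ => ℂ) 1) :
    examplePoly p m x = (exampleCoeff p m : ℂ) •
      ∑ j ∈ sigmaBlock m, (x j) ^ m • lp.single (ENNReal.ofReal p) j (1 : ℂ) := rfl

theorem norm_single_one (p : ℝ) [hp : Fact (1 ≤ p)] (j : ℕ) :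
    ‖(lp.single (ENNReal.ofReal p) j (1 : ℂ) : lp (fun _ : ℕ => ℂ) (ENNReal.ofReal p))‖ = 1 := by
  rw [lp.norm_single (ENNReal.ofReal_pos.2 (by linarith [hp.out])), norm_one]

theorem norm_examplePoly_le (p : ℝ) [Fact (1 ≤ p)] {m : ℕ} (hm : 1 ≤ m)
    {x : lp (fun _ : ℕ => ℂ) 1} (hx : x ∈ closedBall 0 1) :
    ‖examplePoly p m x‖ ≤ exampleCoeff p m := by
  rw [examplePoly_eq, norm_smul, Complex.norm_of_nonneg (exampleCoeff_nonneg p m)]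
  refine mul_le_of_le_one_right (exampleCoeff_nonneg p m) ?_
  refine (norm_sum_le _ _).trans (le_trans (le_of_eq ?_) (sum_norm_pow_le_one hx hm (sigmaBlock m)))
  refine Finset.sum_congr rfl fun j _ => ?_
  rw [norm_smul, norm_single_one, mul_one, norm_pow]

theorem isRelPCompact_examplePoly (p : ℝ) [hp : Fact (1 ≤ p)] {m : ℕ} (hm : 1 ≤ m) :
    IsRelPCompact p (examplePoly p m '' closedBall 0 1) := by
  have hp0 : p ≠ 0 := by linarith [hp.out]
  refine ⟨fun n => if n ∈ sigmaBlock m then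
    (exampleCoeff p m : ℂ) • lp.single (ENNReal.ofReal p) n (1 : ℂ) else 0, ?_, ?_⟩
  · refine summable_of_ne_finset_zero (s := sigmaBlock m) fun n hn => ?_
    simp [hn, Real.zero_rpow hp0]
  · rintro _ ⟨x, hx, rfl⟩
    refine ⟨fun n => if n ∈ sigmaBlock m then x n ^ m else 0,
      conjUnitBall_of_sum_norm_le_one hp.out (s := sigmaBlock m) (fun n hn => if_neg hn) ?_, ?_⟩
    · refine le_trans (le_of_eq ?_) (sum_norm_pow_le_one hx hm (sigmaBlock m))
      refine Finset.sum_congr rfl fun j hj => ?_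
      rw [if_pos hj, norm_pow]
    · have hsum : examplePoly p m x = ∑ n ∈ sigmaBlock m,
          (if n ∈ sigmaBlock m then x n ^ m else 0) • (if n ∈ sigmaBlock m then
            (exampleCoeff p m : ℂ) • lp.single (ENNReal.ofReal p) n (1 : ℂ) else 0) := by
        rw [examplePoly_eq, Finset.smul_sum]
        refine Finset.sum_congr rfl fun j hj => ?_
        rw [if_pos hj, if_pos hj, smul_comm]
      rw [hsum]
      refine hasSum_sum_of_ne_finset_zero fun n hn => ?_
      simp only [if_neg hn, zero_smul]

theorem examplePoly_single_apply (p : ℝ) [Fact (1 ≤ p)] {m j : ℕ}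
    (hj : j ∈ sigmaBlock m) :
    examplePoly p m (lp.single 1 j (1 : ℂ)) j = exampleCoeff p m := by
  rw [examplePoly_eq, lp.coeFn_smul, Pi.smul_apply, lp.coeFn_sum, Finset.sum_apply,
    Finset.sum_eq_single_of_mem j hj]
  · simp
  · intro i _ hij
    simp [hij]

/-- If `p-co{y_n}` contains the image of the unit ball, then each coordinate in the `m`-th block
carries at least the `p`-th power of the scaling constant. -/
theorem exampleCoeff_rpow_le_tsum (p : ℝ) [hp : Fact (1 ≤ p)] {m : ℕ}
    {y : ℕ → lp (fun _ : ℕ => ℂ) (ENNReal.ofReal p)}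
    (hcov : examplePoly p m '' closedBall 0 1 ⊆ pCo p y) {j : ℕ} (hj : j ∈ sigmaBlock m)
    (hy : Summable fun n => ‖y n j‖ ^ p) :
    exampleCoeff p m ^ p ≤ ∑' n, ‖y n j‖ ^ p := by
  obtain ⟨α, hα, hsum⟩ := hcov ⟨lp.single 1 j (1 : ℂ), by
    rw [mem_closedBall_zero_iff, lp.norm_single zero_lt_one, norm_one], rfl⟩
  have hb := (lp.evalCLM ℂ (fun _ : ℕ => ℂ) (ENNReal.ofReal p) j).hasSum hsum
  have hb' : HasSum (fun n => α n * y n j) (exampleCoeff p m : ℂ) := by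
    rw [← examplePoly_single_apply p hj]
    exact hb
  simpa only [Complex.norm_of_nonneg (exampleCoeff_nonneg p m)] using
    hα.norm_rpow_le_tsum hp.out hy hb'

theorem rpow_le_tsum_norm_rpow (p : ℝ) [hp : Fact (1 ≤ p)] {m : ℕ} (hm : 1 ≤ m)
    {y : ℕ → lp (fun _ : ℕ => ℂ) (ENNReal.ofReal p)} (hy : Summable fun n => ‖y n‖ ^ p)
    (hcov : examplePoly p m '' closedBall 0 1 ⊆ pCo p y) :
    (m : ℝ) ^ ((m : ℝ) / 2) ≤ ∑' n, ‖y n‖ ^ p := by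
  have hp0 : 0 < p := by linarith [hp.out]
  have hsum : ∀ (s : Finset ℕ) (n : ℕ), ∑ j ∈ s, ‖y n j‖ ^ p ≤ ‖y n‖ ^ p := fun s n => by
    have h := lp.sum_rpow_le_norm_rpow (by rwa [ENNReal.toReal_ofReal hp0.le]) (y n) s
    rwa [ENNReal.toReal_ofReal hp0.le] at h
  have hyj : ∀ j, Summable fun n => ‖y n j‖ ^ p := fun j =>
    Summable.of_nonneg_of_le (fun n => by positivity) (fun n => by simpa using hsum {j} n) hy
  calc (m : ℝ) ^ ((m : ℝ) / 2) = ∑ _j ∈ sigmaBlock m, exampleCoeff p m ^ p := by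
        rw [Finset.sum_const, card_sigmaBlock hm, nsmul_eq_mul, exampleCoeff_rpow hp.out,
          mul_div_cancel₀ _ (by positivity)]
    _ ≤ ∑ j ∈ sigmaBlock m, ∑' n, ‖y n j‖ ^ p :=
        Finset.sum_le_sum fun j hj => exampleCoeff_rpow_le_tsum p hcov hj (hyj j)
    _ = ∑' n, ∑ j ∈ sigmaBlock m, ‖y n j‖ ^ p :=
        (Summable.tsum_finsetSum fun j _ => hyj j).symm
    _ ≤ ∑' n, ‖y n‖ ^ p :=
        (summable_sum fun j _ => hyj j).tsum_le_tsum (hsum (sigmaBlock m)) hy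

/-- **(key estimates of Example 3.7).** For `1 ≤ p < ∞` and the blocks `σ_m` of `m!`
consecutive integers, the `m`-homogeneous polynomial
`P_m(x) = (m^{m/2}/m!)^{1/p} ∑_{j∈σ_m} (e'_j(x))^m e_j : ℓ₁ → ℓ_p` satisfies
`‖P_m‖ ≤ (m^{m/2}/m!)^{1/p}`, `P_m` is `p`-compact, and `κ_p(P_m) ≥ m^{m/(2p)}`. -/
theorem statement10 (p : ℝ) [hp : Fact (1 ≤ p)] (m : ℕ) (hm : 1 ≤ m) :
    (∀ x ∈ closedBall (0 : lp (fun _ : ℕ => ℂ) 1) 1,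
      ‖examplePoly p m x‖ ≤ ((m : ℝ) ^ ((m : ℝ) / 2) / (Nat.factorial m : ℝ)) ^ (1 / p)) ∧
    IsRelPCompact p (examplePoly p m '' closedBall 0 1) ∧
    (m : ℝ) ^ ((m : ℝ) / (2 * p)) ≤ mP p (examplePoly p m '' closedBall 0 1) := by
  refine ⟨fun x hx => norm_examplePoly_le p hm hx, isRelPCompact_examplePoly p hm, ?_⟩
  obtain ⟨y, hy, hcov⟩ := isRelPCompact_examplePoly p hm
  refine le_csInf ⟨_, y, hy, hcov, rfl⟩ ?_
  rintro _ ⟨z, hz, hzcov, rfl⟩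
  have hp0 : 0 < p := by linarith [hp.out]
  calc (m : ℝ) ^ ((m : ℝ) / (2 * p)) = ((m : ℝ) ^ ((m : ℝ) / 2)) ^ (1 / p) := by
        rw [← Real.rpow_mul (Nat.cast_nonneg m), div_mul_div_comm, mul_one]
    _ ≤ (∑' n, ‖z n‖ ^ p) ^ (1 / p) :=
        Real.rpow_le_rpow (by positivity) (rpow_le_tsum_norm_rpow p hm hz hzcov) (by positivity)

end
end
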